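/- Let p, q ≥ 2 be coprime integers. Then 0 < −3·∫₀¹ σ_{p,q}(x) dx − M − μ < 2/9, where μ = (p−1)(q−1) is the Milnor number of the singularity x^p − y^q = 0 and M = p + q − p/q − q/p − 1 is its M-number. -/

import Mathlib

open Classical in
/-- The Tristram–Levine signature of the `(p,q)`-torus knot, given by the
combinatorial formula of Example 4.1:
`σ_{p,q}(x) = #{(i,j) : i/p + j/q ∉ (x, x+1)} − #{(i,j) : i/p + j/q ∈ (x, x+1)}`,
where `(i,j)` ranges over pairs with `1 ≤ i ≤ p−1`, `1 ≤ j ≤ q−1`. -/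
noncomputable def torusSignature (p q : ℕ) (x : ℝ) : ℝ :=
  (((Finset.Icc 1 (p - 1)) ×ˢ (Finset.Icc 1 (q - 1))).filter
      (fun ij : ℕ × ℕ =>
        (ij.1 : ℝ) / p + (ij.2 : ℝ) / q ∉ Set.Ioo x (x + 1))).card
  - (((Finset.Icc 1 (p - 1)) ×ˢ (Finset.Icc 1 (q - 1))).filter
      (fun ij : ℕ × ℕ =>
        (ij.1 : ℝ) / p + (ij.2 : ℝ) / q ∈ Set.Ioo x (x + 1))).card

open MeasureTheory in
/-- The length of the set of `x ∈ (0,1)` with `s ∈ (x, x+1)`. -/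
theorem integral_indicator_Ioo_sub_one {s : ℝ} (h0 : 0 ≤ s) (h2 : s ≤ 2) :
    ∫ x in (0:ℝ)..1, (Set.Ioo (s - 1) s).indicator (fun _ => (1:ℝ)) x = 1 - |s - 1| := by
  rw [intervalIntegral.integral_of_le zero_le_one, setIntegral_indicator measurableSet_Ioo,
    setIntegral_const, smul_eq_mul, mul_one,
    measureReal_congr ((Filter.EventuallyEq.refl _ _).inter
      (Ioo_ae_eq_Ioc (μ := volume) (a := s - 1) (b := s))),
    Set.Ioc_inter_Ioc, Real.volume_real_Ioc]
  rcases le_total s 1 with h | h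
  · rw [abs_of_nonpos (by linarith), max_eq_left (by linarith : s - 1 ≤ 0), min_eq_right h,
      max_eq_left (by linarith)]
    ring
  · rw [abs_of_nonneg (by linarith), max_eq_right (by linarith : 0 ≤ s - 1), min_eq_left h,
      max_eq_left (by linarith)]

theorem torusSignature_eq_sum (p q : ℕ) (x : ℝ) :
    torusSignature p q x = ∑ ij ∈ Finset.Icc 1 (p - 1) ×ˢ Finset.Icc 1 (q - 1),
      (1 - 2 * (Set.Ioo ((ij.1 : ℝ) / p + (ij.2 : ℝ) / q - 1)
        ((ij.1 : ℝ) / p + (ij.2 : ℝ) / q)).indicator (fun _ => (1:ℝ)) x) := by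
  classical
  rw [torusSignature, Finset.card_filter, Finset.card_filter, Nat.cast_sum, Nat.cast_sum,
    ← Finset.sum_sub_distrib]
  refine Finset.sum_congr rfl fun ij _ => ?_
  have h : x ∈ Set.Ioo ((ij.1 : ℝ) / p + (ij.2 : ℝ) / q - 1) ((ij.1 : ℝ) / p + (ij.2 : ℝ) / q) ↔
      (ij.1 : ℝ) / p + (ij.2 : ℝ) / q ∈ Set.Ioo x (x + 1) := by
    rw [Set.mem_Ioo, Set.mem_Ioo, sub_lt_iff_lt_add]
    exact and_comm
  rw [Set.indicator_apply]
  simp only [h]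
  split_ifs <;> norm_num

open MeasureTheory in
theorem integral_torusSignature_eq_sum (p q : ℕ) :
    ∫ x in (0:ℝ)..1, torusSignature p q x =
      ∑ i ∈ Finset.Icc 1 (p - 1), ∑ j ∈ Finset.Icc 1 (q - 1),
        (2 * |(i : ℝ) / p + (j : ℝ) / q - 1| - 1) := by
  have hint : ∀ s : ℝ, IntervalIntegrable
      ((Set.Ioo (s - 1) s).indicator fun _ => (1:ℝ)) volume 0 1 := fun s =>
    ((integrable_indicator_iff measurableSet_Ioo).2
      (integrableOn_const (by simp))).intervalIntegrable
  simp_rw [torusSignature_eq_sum]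
  rw [intervalIntegral.integral_finsetSum
    fun ij _ => intervalIntegrable_const.sub ((hint _).const_mul 2), ← Finset.sum_product']
  refine Finset.sum_congr rfl fun ij hij => ?_
  have hle : ∀ {k n : ℕ}, k ∈ Finset.Icc 1 (n - 1) → (k : ℝ) / n ≤ 1 := fun {k n} hk =>
    div_le_one_of_le₀ (by have := Finset.mem_Icc.1 hk; exact_mod_cast (by omega : k ≤ n))
      n.cast_nonneg
  have h1 := hle (Finset.mem_product.1 hij).1
  have h2 := hle (Finset.mem_product.1 hij).2
  rw [intervalIntegral.integral_sub intervalIntegrable_const ((hint _).const_mul 2),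
    intervalIntegral.integral_const_mul, integral_indicator_Ioo_sub_one (by positivity)
      (by linarith), intervalIntegral.integral_const, smul_eq_mul]
  ring

/-- The Chinese remainder theorem as a reindexing of sums. -/
theorem sum_range_mul_of_coprime {M : Type*} [AddCommMonoid M] {p q : ℕ} (hp : 0 < p) (hq : 0 < q)
    (hpq : Nat.Coprime p q) (f : ℕ → M) :
    ∑ i ∈ Finset.range p, ∑ j ∈ Finset.range q, f ((i * q + j * p) % (p * q)) =
      ∑ k ∈ Finset.range (p * q), f k := by
  have hinj : Set.InjOn (fun ij : ℕ × ℕ => (ij.1 * q + ij.2 * p) % (p * q))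
      ↑(Finset.range p ×ˢ Finset.range q) := by
    rintro ⟨i, j⟩ hij ⟨i', j'⟩ hij' h
    simp only [Finset.coe_product, Set.mem_prod, Finset.mem_coe, Finset.mem_range] at hij hij'
    have h : i * q + j * p ≡ i' * q + j' * p [MOD p * q] := h
    have hi : i * q ≡ i' * q [MOD p] := by
      simpa [Nat.ModEq] using h.of_mul_right q
    have hj : j * p ≡ j' * p [MOD q] := by
      simpa [Nat.ModEq] using h.of_mul_left p
    exact Prod.ext
      ((Nat.ModEq.cancel_right_of_coprime hpq hi).eq_of_lt_of_lt hij.1 hij'.1)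
      ((Nat.ModEq.cancel_right_of_coprime hpq.symm hj).eq_of_lt_of_lt hij.2 hij'.2)
  have himage : (Finset.range p ×ˢ Finset.range q).image
      (fun ij : ℕ × ℕ => (ij.1 * q + ij.2 * p) % (p * q)) = Finset.range (p * q) := by
    refine Finset.eq_of_subset_of_card_le (fun k hk => ?_) ?_
    · obtain ⟨ij, -, rfl⟩ := Finset.mem_image.1 hk
      exact Finset.mem_range.2 (Nat.mod_lt _ (Nat.mul_pos hp hq))
    · rw [Finset.card_image_of_injOn hinj]
      simp
  rw [← himage, Finset.sum_image hinj, Finset.sum_product]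

theorem sum_range_cast (n : ℕ) : ∑ k ∈ Finset.range n, (k : ℝ) = n * (n - 1) / 2 := by
  induction n with
  | zero => simp
  | succ n ih => rw [Finset.sum_range_succ, ih]; push_cast; ring

theorem sum_range_cast_sq (n : ℕ) :
    ∑ k ∈ Finset.range n, (k : ℝ) ^ 2 = n * (n - 1) * (2 * n - 1) / 6 := by
  induction n with
  | zero => simp
  | succ n ih => rw [Finset.sum_range_succ, ih]; push_cast; ring

theorem sum_Icc_one_pred {n : ℕ} (hn : 0 < n) (f : ℕ → ℝ) :
    ∑ k ∈ Finset.Icc 1 (n - 1), f k = ∑ k ∈ Finset.range n, f k - f 0 := by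
  have h : Finset.range n = insert 0 (Finset.Icc 1 (n - 1)) := by
    ext k
    simp only [Finset.mem_range, Finset.mem_insert, Finset.mem_Icc]
    omega
  rw [h, Finset.sum_insert (by simp)]
  ring

/-- `|u - 1| = (u - 1)² - B` with `B = {u}² - {u}`, for `u = i/p + j/q ∈ [0, 2)`. -/
theorem abs_div_add_div_sub_one {p q i j : ℕ} (hi : i < p) (hj : j < q) :
    |(i : ℝ) / p + (j : ℝ) / q - 1| = ((i : ℝ) / p + (j : ℝ) / q - 1) ^ 2
      - (((((i * q + j * p) % (p * q) : ℕ) : ℝ) / (p * q)) ^ 2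
        - (((i * q + j * p) % (p * q) : ℕ) : ℝ) / (p * q)) := by
  have hp : (0 : ℝ) < p := by exact_mod_cast (by omega : 0 < p)
  have hq : (0 : ℝ) < q := by exact_mod_cast (by omega : 0 < q)
  have hu : (i : ℝ) / p + (j : ℝ) / q = ((i * q + j * p : ℕ) : ℝ) / (p * q) := by
    push_cast
    field_simp
  rcases lt_or_ge (i * q + j * p) (p * q) with h | h
  · have h1 : (i : ℝ) / p + (j : ℝ) / q < 1 := by
      rw [hu, div_lt_one (by positivity)]
      exact_mod_cast h
    rw [Nat.mod_eq_of_lt h, ← hu, abs_of_neg (by linarith)]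
    ring
  · have h1 : 1 ≤ (i : ℝ) / p + (j : ℝ) / q := by
      rw [hu, one_le_div (by positivity)]
      exact_mod_cast h
    have h2 : i * q + j * p - p * q < p * q := by
      have := Nat.mul_lt_mul_of_pos_right hi (Nat.zero_lt_of_lt hj)
      have := Nat.mul_lt_mul_of_pos_right hj (Nat.zero_lt_of_lt hi)
      rw [mul_comm q p] at this
      omega
    have h3 : ((i * q + j * p - p * q : ℕ) : ℝ) / (p * q) = (i : ℝ) / p + (j : ℝ) / q - 1 := by
      rw [Nat.cast_sub h, hu, sub_div, Nat.cast_mul p q, div_self (by positivity)]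
    rw [Nat.mod_eq_sub_mod h, Nat.mod_eq_of_lt h2, h3, abs_of_nonneg (by linarith)]
    ring

theorem sum_abs_div_add_div_sub_one {p q : ℕ} (hp : 0 < p) (hq : 0 < q)
    (hpq : Nat.Coprime p q) :
    ∑ i ∈ Finset.range p, ∑ j ∈ Finset.range q, |(i : ℝ) / p + (j : ℝ) / q - 1| =
      (2 * (p : ℝ) ^ 2 * q ^ 2 + p ^ 2 + q ^ 2 + 3 * p * q - 1) / (6 * p * q) := by
  have hp' : (p : ℝ) ≠ 0 := by positivity
  have hq' : (q : ℝ) ≠ 0 := by positivity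
  have hsq : ∀ i j : ℕ, ((i : ℝ) / p + (j : ℝ) / q - 1) ^ 2 =
      (i : ℝ) ^ 2 * (1 / p ^ 2) + (j : ℝ) ^ 2 * (1 / q ^ 2) + 1 + (i * (2 / (p * q))) * j
        - i * (2 / p) - j * (2 / q) := fun i j => by
    field_simp
    ring
  have hres := sum_range_mul_of_coprime hp hq hpq
    fun k => ((k : ℝ) / (p * q)) ^ 2 - (k : ℝ) / (p * q)
  have habs : ∑ i ∈ Finset.range p, ∑ j ∈ Finset.range q, |(i : ℝ) / p + (j : ℝ) / q - 1| =
      ∑ i ∈ Finset.range p, ∑ j ∈ Finset.range q, (((i : ℝ) / p + (j : ℝ) / q - 1) ^ 2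
      - (((((i * q + j * p) % (p * q) : ℕ) : ℝ) / (p * q)) ^ 2
        - (((i * q + j * p) % (p * q) : ℕ) : ℝ) / (p * q))) :=
    Finset.sum_congr rfl fun i hi => Finset.sum_congr rfl fun j hj =>
      abs_div_add_div_sub_one (Finset.mem_range.1 hi) (Finset.mem_range.1 hj)
  rw [habs]
  simp only [Finset.sum_sub_distrib] at hres ⊢
  rw [hres]
  simp only [hsq, div_pow, ← Finset.sum_div, Finset.sum_add_distrib, Finset.sum_sub_distrib,
    ← Finset.sum_mul, ← Finset.mul_sum, sum_range_cast, sum_range_cast_sq, Finset.sum_const,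
    Finset.card_range, nsmul_eq_mul]
  push_cast
  field_simp
  ring

theorem sum_abs_div_sub_one {n : ℕ} (hn : 0 < n) :
    ∑ k ∈ Finset.range n, |(k : ℝ) / n - 1| = (n + 1) / 2 := by
  have hn' : (n : ℝ) ≠ 0 := by positivity
  have h : ∀ k ∈ Finset.range n, |(k : ℝ) / n - 1| = 1 - (k : ℝ) / n := fun k hk => by
    have : (k : ℝ) / n ≤ 1 := div_le_one_of_le₀
      (by exact_mod_cast (Finset.mem_range.1 hk).le) n.cast_nonneg
    rw [abs_of_nonpos (by linarith), neg_sub]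
  rw [Finset.sum_congr rfl h, Finset.sum_sub_distrib, ← Finset.sum_div, sum_range_cast]
  simp only [Finset.sum_const, Finset.card_range, nsmul_eq_mul]
  field_simp
  ring

/-- The integral of the Tristram–Levine signature of a torus knot. -/
theorem integral_torusSignature {p q : ℕ} (hp : 0 < p) (hq : 0 < q) (hpq : Nat.Coprime p q) :
    ∫ x in (0:ℝ)..1, torusSignature p q x =
      -((p : ℝ) - 1 / p) * ((q : ℝ) - 1 / q) / 3 := by
  have hp' : (p : ℝ) ≠ 0 := by positivity
  have hq' : (q : ℝ) ≠ 0 := by positivity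
  rw [integral_torusSignature_eq_sum]
  simp only [Finset.sum_sub_distrib, ← Finset.mul_sum, sum_Icc_one_pred hp, sum_Icc_one_pred hq,
    sum_abs_div_add_div_sub_one hp hq hpq, Nat.cast_zero, zero_div, zero_add, add_zero,
    sum_abs_div_sub_one hp, sum_abs_div_sub_one hq, Finset.sum_const, Finset.card_range,
    nsmul_eq_mul, zero_sub, abs_neg, abs_one]
  field_simp
  ring


/-- Proposition 4.2 of the paper specialized to the `(p,q)`-torus knot:
`0 < −3∫₀¹ σ_{p,q}(x) dx − M − μ < 2/9`, where `μ = (p−1)(q−1)` and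
`M = p + q − p/q − q/p − 1`. -/
theorem torus_signature_integral_bounds (p q : ℕ) (hp : 2 ≤ p) (hq : 2 ≤ q)
    (hpq : Nat.Coprime p q) :
    0 < -3 * (∫ x in (0:ℝ)..1, torusSignature p q x)
        - ((p : ℝ) + q - (p : ℝ) / q - (q : ℝ) / p - 1)
        - ((p : ℝ) - 1) * ((q : ℝ) - 1) ∧
    -3 * (∫ x in (0:ℝ)..1, torusSignature p q x)
        - ((p : ℝ) + q - (p : ℝ) / q - (q : ℝ) / p - 1)
        - ((p : ℝ) - 1) * ((q : ℝ) - 1) < 2 / 9 := by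
  have hp' : (2 : ℝ) ≤ p := by exact_mod_cast hp
  have hq' : (2 : ℝ) ≤ q := by exact_mod_cast hq
  have h6 : (6 : ℝ) ≤ p * q := by
    have hne : p ≠ q := by
      rintro rfl
      have := (Nat.coprime_self p).1 hpq
      omega
    rcases lt_or_gt_of_ne hne with h | h
    · have h3 : (3 : ℝ) ≤ q := by exact_mod_cast (by omega : 3 ≤ q)
      nlinarith
    · have h3 : (3 : ℝ) ≤ p := by exact_mod_cast (by omega : 3 ≤ p)
      nlinarith
  have key : -3 * (∫ x in (0:ℝ)..1, torusSignature p q x)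
      - ((p : ℝ) + q - (p : ℝ) / q - (q : ℝ) / p - 1)
      - ((p : ℝ) - 1) * ((q : ℝ) - 1) = 1 / (p * q) := by
    rw [integral_torusSignature (by omega) (by omega) hpq]
    field_simp
    ring
  rw [key]
  refine ⟨by positivity, ?_⟩
  rw [div_lt_iff₀ (by linarith)]
  linarith
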